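/- Let φ : [1,∞) → (0,∞) be a C¹, increasing, concave (sublinear) function with φ' > 0. Suppose there exist a C² function W : ℝⁿ → ℝ with W ≥ 1 and constants b > 0, R > 0 such that LW(x) ≤ −φ(W(x)) + b·1_{|x| ≤ R}(x) for all x, and suppose μ satisfies the local Poincaré inequality on B(0,R) with constant κ_R. Then for every smooth compactly supported function f, Var_μ(f) ≤ max(b κ_R/φ(1), 1) ∫ (1 + 1/φ'(W)) |∇f|² dμ. -/

import Mathlib

open MeasureTheory Real Set
open scoped ENNReal RealInnerProductSpace

noncomputable section

abbrev En (n : ℕ) := EuclideanSpace ℝ (Fin n)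

/-- The Laplacian on `ℝⁿ`: sum of second partial derivatives. -/
def lapl {n : ℕ} (g : En n → ℝ) (x : En n) : ℝ :=
  ∑ i : Fin n,
    fderiv ℝ (fun y => fderiv ℝ g y (EuclideanSpace.single i 1)) x (EuclideanSpace.single i 1)

/-- The diffusion operator `L g = Δ g - ∇V · ∇g`. -/
def Lop {n : ℕ} (V g : En n → ℝ) (x : En n) : ℝ :=
  lapl g x - ⟪gradient V x, gradient g x⟫

/-- The Boltzmann measure `dμ = e^{-V}/Z dx`. -/
def boltz {n : ℕ} (V : En n → ℝ) : Measure (En n) :=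
  (volume : Measure (En n)).withDensity
    (fun x => ENNReal.ofReal (Real.exp (-V x) / ∫ y, Real.exp (-V y)))

open scoped Topology
open Filter

lemma integral_fderiv_apply_eq_zero {n : ℕ} {u : En n → ℝ} (hu : ContDiff ℝ 1 u)
    (huc : HasCompactSupport u) (v : En n) : ∫ x, fderiv ℝ u x v = 0 := by
  have hint : Integrable (fun x => fderiv ℝ u x v) :=
    ((hu.continuous_fderiv one_ne_zero).clm_apply continuous_const).integrable_of_hasCompactSupport
      (huc.fderiv_apply (𝕜 := ℝ) v)
  have h := integral_mul_fderiv_eq_neg_fderiv_mul_of_integrable (μ := (volume : Measure (En n)))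
    (f := fun _ : En n => (1 : ℝ)) (g := u) (v := v) (by simp) (by simpa using hint)
    (by simpa using hu.continuous.integrable_of_hasCompactSupport huc)
    (fun _ _ => by fun_prop) (fun x _ => hu.differentiable one_ne_zero x)
  simpa using h

lemma inner_gradient_eq_sum {n : ℕ} (g h : En n → ℝ) (x : En n) :
    ⟪gradient g x, gradient h x⟫ = ∑ i : Fin n,
      fderiv ℝ g x (EuclideanSpace.single i 1) * fderiv ℝ h x (EuclideanSpace.single i 1) := by
  rw [← (EuclideanSpace.basisFun (Fin n) ℝ).sum_inner_mul_inner]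
  refine Finset.sum_congr rfl fun i _ => ?_
  rw [EuclideanSpace.basisFun_apply, real_inner_comm (gradient h x)]
  simp [gradient]

lemma inner_gradient_right_eq {n : ℕ} (g : En n → ℝ) (v x : En n) :
    ⟪v, gradient g x⟫ = fderiv ℝ g x v := by
  rw [real_inner_comm]; simp [gradient]

lemma norm_gradient_eq {n : ℕ} (g : En n → ℝ) (x : En n) :
    ‖gradient g x‖ = ‖fderiv ℝ g x‖ := by
  simp [gradient]

lemma continuous_gradient {n : ℕ} {g : En n → ℝ} (hg : ContDiff ℝ 1 g) :
    Continuous (gradient g) :=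
  (InnerProductSpace.toDual ℝ (En n)).symm.continuous.comp (hg.continuous_fderiv one_ne_zero)

lemma contDiff_fderiv_apply {n : ℕ} {g : En n → ℝ} (hg : ContDiff ℝ 2 g) (v : En n) :
    ContDiff ℝ 1 (fun y => fderiv ℝ g y v) :=
  (hg.fderiv_right (m := 1) (by norm_num)).clm_apply contDiff_const

lemma continuous_lapl {n : ℕ} {g : En n → ℝ} (hg : ContDiff ℝ 2 g) : Continuous (lapl g) :=
  continuous_finsetSum _ fun _ _ =>
    ((contDiff_fderiv_apply hg _).continuous_fderiv one_ne_zero).clm_apply continuous_const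

lemma continuous_Lop {n : ℕ} {V g : En n → ℝ} (hV : ContDiff ℝ 2 V) (hg : ContDiff ℝ 2 g) :
    Continuous (Lop V g) :=
  (continuous_lapl hg).sub ((continuous_gradient (hV.of_le (by norm_num))).inner
    (continuous_gradient (hg.of_le (by norm_num))))

lemma integral_boltz {n : ℕ} {V : En n → ℝ} (hV : Continuous V) (g : En n → ℝ) :
    ∫ x, g x ∂(boltz V) = ∫ x, Real.exp (-V x) / (∫ y, Real.exp (-V y)) * g x := by
  unfold boltz
  rw [integral_withDensity_eq_integral_toReal_smul (by fun_prop) (by simp)]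
  refine integral_congr_ae (.of_forall fun x => ?_)
  have : 0 ≤ ∫ y, Real.exp (-V y) := integral_nonneg fun _ => (Real.exp_pos _).le
  simp only [smul_eq_mul]
  rw [ENNReal.toReal_ofReal (by positivity)]

lemma isProbabilityMeasure_boltz {n : ℕ} {V : En n → ℝ}
    (hVint : Integrable (fun x => Real.exp (-V x))) : IsProbabilityMeasure (boltz V) := by
  have hZ : 0 < ∫ y, Real.exp (-V y) := integral_exp_pos hVint
  constructor
  unfold boltz
  rw [withDensity_apply _ MeasurableSet.univ, Measure.restrict_univ,
    ← ofReal_integral_eq_lintegral_ofReal (hVint.div_const _)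
      (.of_forall fun x => by positivity), integral_div, div_self hZ.ne', ENNReal.ofReal_one]

lemma sum_fderiv_mul_exp {n : ℕ} {V W η : En n → ℝ} (hV : ContDiff ℝ 2 V) (hW : ContDiff ℝ 2 W)
    (hη : ContDiff ℝ 1 η) (x : En n) :
    ∑ i : Fin n, fderiv ℝ (fun y => fderiv ℝ W y (EuclideanSpace.single i 1)
        * (η y * Real.exp (-V y))) x (EuclideanSpace.single i 1)
      = Real.exp (-V x) * (Lop V W x * η x + ⟪gradient W x, gradient η x⟫) := by
  have hVd : DifferentiableAt ℝ V x := hV.differentiable two_ne_zero x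
  have hηd : DifferentiableAt ℝ η x := hη.differentiable one_ne_zero x
  rw [Lop, inner_gradient_eq_sum, inner_gradient_eq_sum, lapl, ← Finset.sum_sub_distrib,
    Finset.sum_mul, ← Finset.sum_add_distrib, Finset.mul_sum]
  refine Finset.sum_congr rfl fun i _ => ?_
  have hWd := ((contDiff_fderiv_apply hW (EuclideanSpace.single i 1)).differentiable
    one_ne_zero x).hasFDerivAt
  have hd := hWd.fun_mul (hηd.hasFDerivAt.fun_mul hVd.hasFDerivAt.fun_neg.exp)
  rw [hd.fderiv]
  simp
  ring

lemma integral_Lop_mul_add_inner_eq_zero {n : ℕ} {V W η : En n → ℝ} (hV : ContDiff ℝ 2 V)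
    (hW : ContDiff ℝ 2 W) (hη : ContDiff ℝ 1 η) (hηc : HasCompactSupport η) :
    ∫ x, (Lop V W x * η x + ⟪gradient W x, gradient η x⟫) ∂(boltz V) = 0 := by
  have hV1 : ContDiff ℝ 1 V := hV.of_le (by norm_num)
  have hu (i : Fin n) : ContDiff ℝ 1 (fun y => fderiv ℝ W y (EuclideanSpace.single i 1)
      * (η y * Real.exp (-V y))) :=
    (contDiff_fderiv_apply hW _).mul (hη.mul hV1.neg.exp)
  have huc (i : Fin n) : HasCompactSupport (fun y => fderiv ℝ W y (EuclideanSpace.single i 1)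
      * (η y * Real.exp (-V y))) := (hηc.mul_right).mul_left
  rw [integral_boltz hV.continuous]
  calc _ = ∫ x, (∫ y, Real.exp (-V y))⁻¹ * ∑ i : Fin n,
        fderiv ℝ (fun y => fderiv ℝ W y (EuclideanSpace.single i 1)
        * (η y * Real.exp (-V y))) x (EuclideanSpace.single i 1) := by
        congr 1 with x
        rw [sum_fderiv_mul_exp hV hW hη]; ring
    _ = 0 := by
        rw [integral_const_mul, integral_finsetSum]
        · simp only [integral_fderiv_apply_eq_zero (hu _) (huc _), Finset.sum_const_zero, mul_zero]
        · exact fun i _ => (((hu i).continuous_fderiv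
            one_ne_zero).clm_apply continuous_const).integrable_of_hasCompactSupport
            ((huc i).fderiv_apply (𝕜 := ℝ) _)

/-- The `L`-Lyapunov inequality tested against `ψ² / D`, where `∇D = s ∇W`. -/
lemma integral_le_of_lyapunov_of_hasCompactSupport {n : ℕ} {V W : En n → ℝ}
    (hV : ContDiff ℝ 2 V) (hVint : Integrable (fun x => Real.exp (-V x))) (hW : ContDiff ℝ 2 W)
    {D p s : En n → ℝ} {A : Set (En n)} {b β : ℝ} (hA : MeasurableSet A)
    (hD : ContDiff ℝ 1 D) (hD0 : ∀ x, 0 < D x) (hDs : ∀ x, fderiv ℝ D x = s x • fderiv ℝ W x)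
    (hs : Continuous s) (hs0 : ∀ x, 0 < s x) (hp : Continuous p)
    (hL : ∀ x, Lop V W x ≤ -p x + A.indicator (fun _ => b) x) (hβ : ∀ x, b / D x ≤ β)
    {ψ : En n → ℝ} (hψ : ContDiff ℝ 1 ψ) (hψc : HasCompactSupport ψ) :
    ∫ x, p x / D x * ψ x ^ 2 ∂(boltz V) ≤
      ∫ x, ‖fderiv ℝ ψ x‖ ^ 2 / s x ∂(boltz V) + β * ∫ x in A, ψ x ^ 2 ∂(boltz V) := by
  have := isProbabilityMeasure_boltz hVint
  set η : En n → ℝ := fun x => ψ x ^ 2 / D x with hη_def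
  have hη : ContDiff ℝ 1 η := (hψ.pow 2).div hD fun x => (hD0 x).ne'
  have hψ2c : HasCompactSupport (fun x => ψ x ^ 2) :=
    hψc.comp_left (g := fun t : ℝ => t ^ 2) (by simp)
  have hηc : HasCompactSupport η := by
    simp only [hη_def, div_eq_mul_inv]
    exact hψ2c.mul_right
  have hgc : HasCompactSupport (gradient η) :=
    (hηc.fderiv (𝕜 := ℝ)).comp_left (g := (InnerProductSpace.toDual ℝ (En n)).symm) (by simp)
  have hIQ : Integrable (fun x => Lop V W x * η x + ⟪gradient W x, gradient η x⟫) (boltz V) := by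
    refine Integrable.add ?_ ?_
    · exact ((continuous_Lop hV hW).mul hη.continuous).integrable_of_hasCompactSupport
        hηc.mul_left
    · refine ((continuous_gradient (hW.of_le (by norm_num))).inner
        (continuous_gradient hη)).integrable_of_hasCompactSupport ?_
      exact hgc.mono fun x hx h => hx (by simp [h])
  have hI1 : Integrable (fun x => p x / D x * ψ x ^ 2) (boltz V) :=
    ((hp.div hD.continuous fun x => (hD0 x).ne').mul
      (hψ.continuous.pow 2)).integrable_of_hasCompactSupport hψ2c.mul_left
  have hI2 : Integrable (fun x => ‖fderiv ℝ ψ x‖ ^ 2 / s x) (boltz V) := by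
    refine (((hψ.continuous_fderiv one_ne_zero).norm.pow 2).div hs
      fun x => (hs0 x).ne').integrable_of_hasCompactSupport ?_
    exact (hψc.fderiv (𝕜 := ℝ)).mono fun x hx h => hx (by simp [h])
  have hI3 : Integrable (A.indicator fun x => ψ x ^ 2) (boltz V) :=
    ((hψ.continuous.pow 2).integrable_of_hasCompactSupport hψ2c).indicator hA
  have hpt (x : En n) : p x / D x * ψ x ^ 2 ≤ ‖fderiv ℝ ψ x‖ ^ 2 / s x
      + β * A.indicator (fun x => ψ x ^ 2) x
      - (Lop V W x * η x + ⟪gradient W x, gradient η x⟫) := by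
    have hD1 := hD0 x
    have hs1 := hs0 x
    have hη0 : 0 ≤ η x := by positivity
    have h1 : p x / D x * ψ x ^ 2 = p x * η x := by simp only [hη_def]; ring
    have h2 : Lop V W x * η x ≤ -(p x * η x) + β * A.indicator (fun x => ψ x ^ 2) x := by
      refine (mul_le_mul_of_nonneg_right (hL x) hη0).trans ?_
      by_cases hx : x ∈ A
      · simp only [hx, indicator_of_mem]
        have : b * η x = b / D x * ψ x ^ 2 := by simp only [hη_def]; ring
        nlinarith [mul_le_mul_of_nonneg_right (hβ x) (sq_nonneg (ψ x))]
      · simp [hx]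
    have h3 : ⟪gradient W x, gradient η x⟫ ≤ ‖fderiv ℝ ψ x‖ ^ 2 / s x := by
      have hder : HasFDerivAt η (((D x) ^ 2)⁻¹ • (D x • ((2 * ψ x) • fderiv ℝ ψ x)
          - (ψ x ^ 2) • (s x • fderiv ℝ W x))) x := by
        have hd := (hD.differentiable one_ne_zero x).hasFDerivAt
        rw [hDs] at hd
        have hp2 := (hψ.differentiable one_ne_zero x).hasFDerivAt.pow 2
        have hi := (hasDerivAt_inv hD1.ne').comp_hasFDerivAt x hd
        refine (hp2.fun_mul hi).congr_fderiv ?_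
        ext v
        simp
        field_simp
        ring
      have hWW : fderiv ℝ W x (gradient W x) = ‖gradient W x‖ ^ 2 := by
        rw [← inner_gradient_right_eq, real_inner_self_eq_norm_sq]
      have hle : ψ x * fderiv ℝ ψ x (gradient W x)
          ≤ |ψ x| * (‖fderiv ℝ ψ x‖ * ‖gradient W x‖) := by
        refine (le_abs_self _).trans ?_
        rw [abs_mul]
        exact mul_le_mul_of_nonneg_left ((fderiv ℝ ψ x).le_opNorm _) (abs_nonneg _)
      rw [inner_gradient_right_eq, hder.fderiv]
      simp only [_root_.smul_apply, _root_.sub_apply, smul_eq_mul, hWW]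
      rw [← sq_abs (ψ x)]
      generalize ‖gradient W x‖ = w at *
      generalize ‖fderiv ℝ ψ x‖ = q at *
      generalize |ψ x| = a at *
      have h4 : (D x ^ 2)⁻¹ * (D x * (2 * ψ x * (fderiv ℝ ψ x) (gradient W x))
          - a ^ 2 * (s x * w ^ 2)) ≤ (D x ^ 2)⁻¹ * (D x * (2 * (a * (q * w)))
          - a ^ 2 * (s x * w ^ 2)) := by
        gcongr (D x ^ 2)⁻¹ * (D x * ?_ - _)
        linarith
      refine h4.trans ?_
      have h5 : q ^ 2 / s x - (D x ^ 2)⁻¹ * (D x * (2 * (a * (q * w))) - a ^ 2 * (s x * w ^ 2))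
          = (q - s x * a * w / D x) ^ 2 / s x := by
        field_simp
        ring
      have h6 : 0 ≤ (q - s x * a * w / D x) ^ 2 / s x := by positivity
      linarith
    linarith
  calc _ ≤ _ := integral_mono hI1 ((hI2.add (hI3.const_mul β)).sub hIQ) hpt
    _ = _ := by
      simp only [Pi.sub_apply, Pi.add_apply]
      rw [integral_sub (hI2.fun_add (hI3.const_mul β)) hIQ,
        integral_Lop_mul_add_inner_eq_zero hV hW hη hηc, sub_zero,
        integral_add hI2 (hI3.const_mul β), integral_const_mul, integral_indicator hA]

lemma exists_smooth_cutoff (n : ℕ) : ∃ (χ : ℕ → En n → ℝ) (C : ℝ),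
    (∀ k, ContDiff ℝ 1 (χ k)) ∧ (∀ k, HasCompactSupport (χ k)) ∧ (∀ k x, |χ k x| ≤ 1) ∧
    (∀ k x, ‖fderiv ℝ (χ k) x‖ ≤ C) ∧ ∀ x, ∀ᶠ k in atTop, χ k =ᶠ[𝓝 x] 1 := by
  let ρ : ContDiffBump (0 : En n) := ⟨1, 2, one_pos, one_lt_two⟩
  have hρ : ContDiff ℝ 1 ρ := ρ.contDiff
  obtain ⟨C, hC⟩ := (ρ.hasCompactSupport.fderiv (𝕜 := ℝ)).exists_bound_of_continuous
    (hρ.continuous_fderiv one_ne_zero)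
  have hpos (k : ℕ) : (0 : ℝ) < ((k : ℝ) + 1)⁻¹ := by positivity
  refine ⟨fun k x => ρ (((k : ℝ) + 1)⁻¹ • x), C, fun k => by fun_prop,
    fun k => ρ.hasCompactSupport.comp_smul (hpos k).ne', fun k x => ?_, fun k x => ?_, fun x => ?_⟩
  · rw [abs_of_nonneg ρ.nonneg]
    exact ρ.le_one
  · rw [fderiv_comp_smul, norm_smul, Real.norm_of_nonneg (hpos k).le]
    have : ((k : ℝ) + 1)⁻¹ ≤ 1 := inv_le_one_of_one_le₀ (by linarith [k.cast_nonneg (α := ℝ)])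
    exact (mul_le_of_le_one_left (norm_nonneg _) this).trans (hC _)
  · obtain ⟨N, hN⟩ := exists_nat_gt ‖x‖
    filter_upwards [eventually_ge_atTop N] with k hk
    have hball : Metric.ball (0 : En n) (k + 1) ∈ 𝓝 x := by
      refine Metric.isOpen_ball.mem_nhds ?_
      have : (N : ℝ) ≤ k := by exact_mod_cast hk
      rw [mem_ball_zero_iff]; linarith
    filter_upwards [hball] with y hy
    refine ρ.one_of_mem_closedBall ?_
    rw [mem_closedBall_zero_iff, norm_smul, Real.norm_of_nonneg (hpos k).le,
      inv_mul_le_iff₀ (by positivity)]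
    change ‖y‖ ≤ (k + 1) * 1
    rw [mem_ball_zero_iff] at hy
    linarith

lemma integral_le_of_lyapunov_of_bounded {n : ℕ} {V W : En n → ℝ}
    (hV : ContDiff ℝ 2 V) (hVint : Integrable (fun x => Real.exp (-V x))) (hW : ContDiff ℝ 2 W)
    {D p s : En n → ℝ} {A : Set (En n)} {b β ε : ℝ} (hA : MeasurableSet A)
    (hD : ContDiff ℝ 1 D) (hD0 : ∀ x, 0 < D x) (hDs : ∀ x, fderiv ℝ D x = s x • fderiv ℝ W x)
    (hs : Continuous s) (hε : 0 < ε) (hsε : ∀ x, ε ≤ s x) (hp : Continuous p)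
    (hp0 : ∀ x, 0 ≤ p x) (hpD : ∀ x, p x ≤ D x)
    (hL : ∀ x, Lop V W x ≤ -p x + A.indicator (fun _ => b) x) (hβ : ∀ x, b / D x ≤ β)
    {g : En n → ℝ} (hg : ContDiff ℝ 1 g) {M M' : ℝ} (hM : ∀ x, |g x| ≤ M)
    (hM' : ∀ x, ‖fderiv ℝ g x‖ ≤ M') :
    ∫ x, p x / D x * g x ^ 2 ∂(boltz V) ≤
      ∫ x, ‖fderiv ℝ g x‖ ^ 2 / s x ∂(boltz V) + β * ∫ x in A, g x ^ 2 ∂(boltz V) := by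
  have := isProbabilityMeasure_boltz hVint
  obtain ⟨χ, C, hχ, hχc, hχ1, hχC, hχlim⟩ := exists_smooth_cutoff n
  have hs0 (x) : 0 < s x := hε.trans_le (hsε x)
  have hM0 : 0 ≤ M := (abs_nonneg _).trans (hM 0)
  set ψ : ℕ → En n → ℝ := fun k x => χ k x * g x with hψ_def
  have hψ (k) : ContDiff ℝ 1 (ψ k) := (hχ k).mul hg
  have hψc (k) : HasCompactSupport (ψ k) := (hχc k).mul_right
  have hψlim (x) : ∀ᶠ k in atTop, ψ k =ᶠ[𝓝 x] g := by
    filter_upwards [hχlim x] with k hk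
    filter_upwards [hk] with y hy
    simp [hψ_def, hy]
  have hψM (k x) : ψ k x ^ 2 ≤ M ^ 2 := by
    rw [← sq_abs]
    refine pow_le_pow_left₀ (abs_nonneg _) ?_ 2
    rw [hψ_def, abs_mul]
    exact (mul_le_of_le_one_left (abs_nonneg _) (hχ1 k x)).trans (hM x)
  have hψM' (k x) : ‖fderiv ℝ (ψ k) x‖ ≤ M' + M * C := by
    have hd := ((hχ k).differentiable one_ne_zero x).hasFDerivAt.fun_mul
      (hg.differentiable one_ne_zero x).hasFDerivAt
    rw [hψ_def, hd.fderiv]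
    refine (norm_add_le _ _).trans (add_le_add ?_ ?_) <;> rw [norm_smul, Real.norm_eq_abs]
    · exact (mul_le_of_le_one_left (norm_nonneg _) (hχ1 k x)).trans (hM' x)
    · exact mul_le_mul (hM x) (hχC k x) (norm_nonneg _) hM0
  have hlim2 (x) : Tendsto (fun k => ψ k x ^ 2) atTop (𝓝 (g x ^ 2)) :=
    tendsto_nhds_of_eventually_eq ((hψlim x).mono fun k hk => by rw [hk.eq_of_nhds])
  have T1 : Tendsto (fun k => ∫ x, p x / D x * ψ k x ^ 2 ∂(boltz V)) atTop
      (𝓝 (∫ x, p x / D x * g x ^ 2 ∂(boltz V))) := by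
    refine tendsto_integral_of_dominated_convergence (fun _ => M ^ 2) (fun k => ?_)
      (integrable_const _) (fun k => .of_forall fun x => ?_)
      (.of_forall fun x => (hlim2 x).const_mul _)
    · exact ((hp.div hD.continuous fun x => (hD0 x).ne').mul
        ((hψ k).continuous.pow 2)).aestronglyMeasurable
    · have := div_nonneg (hp0 x) (hD0 x).le
      rw [Real.norm_of_nonneg (by positivity)]
      exact (mul_le_of_le_one_left (sq_nonneg _) ((div_le_one (hD0 x)).2 (hpD x))).trans (hψM k x)
  have T2 : Tendsto (fun k => ∫ x, ‖fderiv ℝ (ψ k) x‖ ^ 2 / s x ∂(boltz V)) atTop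
      (𝓝 (∫ x, ‖fderiv ℝ g x‖ ^ 2 / s x ∂(boltz V))) := by
    refine tendsto_integral_of_dominated_convergence (fun _ => (M' + M * C) ^ 2 / ε) (fun k => ?_)
      (integrable_const _) (fun k => .of_forall fun x => ?_) (.of_forall fun x => ?_)
    · exact ((((hψ k).continuous_fderiv one_ne_zero).norm.pow 2).div hs
        fun x => (hs0 x).ne').aestronglyMeasurable
    · have := hs0 x
      rw [Real.norm_of_nonneg (by positivity)]
      exact div_le_div₀ (sq_nonneg _) (pow_le_pow_left₀ (norm_nonneg _) (hψM' k x) 2) hε (hsε x)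
    · exact tendsto_nhds_of_eventually_eq ((hψlim x).mono fun k hk => by rw [hk.fderiv_eq])
  have T3 : Tendsto (fun k => ∫ x in A, ψ k x ^ 2 ∂(boltz V)) atTop
      (𝓝 (∫ x in A, g x ^ 2 ∂(boltz V))) := by
    refine tendsto_integral_of_dominated_convergence (fun _ => M ^ 2)
      (fun k => ((hψ k).continuous.pow 2).aestronglyMeasurable)
      (integrable_const _) (fun k => .of_forall fun x => ?_) (.of_forall hlim2)
    rw [Real.norm_of_nonneg (sq_nonneg _)]
    exact hψM k x
  exact le_of_tendsto_of_tendsto' T1 (T2.add (T3.const_mul β)) fun k =>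
    integral_le_of_lyapunov_of_hasCompactSupport hV hVint hW hA hD hD0 hDs hs hs0 hp hL hβ
      (hψ k) (hψc k)

lemma setIntegral_sub_average_sq {α : Type*} [MeasurableSpace α] {μ : Measure α}
    [IsFiniteMeasure μ] {f : α → ℝ} (hf : Integrable f μ) (hf2 : Integrable (fun x => f x ^ 2) μ)
    (A : Set α) :
    ∫ x in A, (f x - (μ A).toReal⁻¹ * ∫ y in A, f y ∂μ) ^ 2 ∂μ
      = ∫ x in A, f x ^ 2 ∂μ - (μ A).toReal⁻¹ * (∫ x in A, f x ∂μ) ^ 2 := by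
  set a := ∫ y in A, f y ∂μ
  set c := (μ A).toReal⁻¹ * a
  have h : ∀ x, (f x - c) ^ 2 = f x ^ 2 - (2 * c) * f x + c ^ 2 := fun x => by ring
  simp_rw [h]
  rw [integral_add (hf2.integrableOn.fun_sub (hf.integrableOn.const_mul _)) (integrable_const _),
    integral_sub hf2.integrableOn (hf.integrableOn.const_mul _), integral_const_mul]
  simp only [integral_const, Measure.real, Measure.restrict_apply_univ, smul_eq_mul]
  change _ - 2 * c * a + _ = _
  by_cases h0 : (μ A).toReal = 0
  · simp [c, h0]
  · simp only [c]
    field_simp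
    ring

lemma integral_sq_sub_sq_integral_le {α : Type*} [MeasurableSpace α] {μ : Measure α}
    [IsProbabilityMeasure μ] {f : α → ℝ} (hf : Integrable f μ)
    (hf2 : Integrable (fun x => f x ^ 2) μ) (c : ℝ) :
    ∫ x, f x ^ 2 ∂μ - (∫ x, f x ∂μ) ^ 2 ≤ ∫ x, (f x - c) ^ 2 ∂μ := by
  have h : ∀ x, (f x - c) ^ 2 = f x ^ 2 - (2 * c) * f x + c ^ 2 := fun x => by ring
  simp_rw [h]
  have hs : Integrable (fun x => f x ^ 2 - 2 * c * f x) μ := hf2.sub (hf.const_mul _)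
  rw [integral_add hs (integrable_const _),
    integral_sub hf2 (hf.const_mul _), integral_const_mul]
  simp only [integral_const, probReal_univ, one_smul]
  nlinarith [sq_nonneg (∫ x, f x ∂μ - c)]

lemma integrable_sq_of_hasCompactSupport {n : ℕ} {μ : Measure (En n)} [IsFiniteMeasure μ]
    {f : En n → ℝ} (hf : Continuous f) (hfc : HasCompactSupport f) :
    Integrable (fun x => f x ^ 2) μ := by
  have h : HasCompactSupport (fun x => f x ^ 2) :=
    hfc.comp_left (g := fun t : ℝ => t ^ 2) (by simp)
  exact (hf.pow 2).integrable_of_hasCompactSupport h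

lemma integrable_mul_norm_gradient_sq {n : ℕ} {μ : Measure (En n)} [IsFiniteMeasure μ]
    {f w : En n → ℝ} (hf : ContDiff ℝ 1 f) (hfc : HasCompactSupport f) (hw : Continuous w) :
    Integrable (fun x => w x * ‖gradient f x‖ ^ 2) μ := by
  refine (hw.mul ((continuous_gradient hf).norm.pow 2)).integrable_of_hasCompactSupport ?_
  exact (hfc.fderiv (𝕜 := ℝ)).mono fun x hx h => hx (by simp [norm_gradient_eq, h])

/-- The Lyapunov inequality extended to `f - c`, which is not compactly supported: regularizing
`p` to `p + ε W` bounds the weight `1 / (d + ε)`, so cutoffs can be removed before `ε → 0`. -/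
lemma integral_sub_const_sq_le_of_lyapunov {n : ℕ} {V W : En n → ℝ}
    (hV : ContDiff ℝ 2 V) (hVint : Integrable (fun x => Real.exp (-V x))) (hW : ContDiff ℝ 2 W)
    (hW1 : ∀ x, 1 ≤ W x) {p d : En n → ℝ} {A : Set (En n)} {b β : ℝ} (hb : 0 < b)
    (hA : MeasurableSet A) (hp : ContDiff ℝ 1 p) (hp0 : ∀ x, 0 < p x)
    (hpd : ∀ x, fderiv ℝ p x = d x • fderiv ℝ W x) (hd : Continuous d) (hd0 : ∀ x, 0 < d x)
    (hL : ∀ x, Lop V W x ≤ -p x + A.indicator (fun _ => b) x) (hβ : ∀ x, b / p x ≤ β)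
    {f : En n → ℝ} (hf1 : ContDiff ℝ 1 f) (hfc : HasCompactSupport f) (c : ℝ) :
    ∫ x, (f x - c) ^ 2 ∂(boltz V) ≤ ∫ x, 1 / d x * ‖gradient f x‖ ^ 2 ∂(boltz V)
      + β * ∫ x in A, (f x - c) ^ 2 ∂(boltz V) := by
  have hμ := isProbabilityMeasure_boltz hVint
  have hW1' : ContDiff ℝ 1 W := hW.of_le (by norm_num)
  obtain ⟨M₀, hM₀⟩ := hfc.exists_bound_of_continuous hf1.continuous
  obtain ⟨M', hM'⟩ := (hfc.fderiv (𝕜 := ℝ)).exists_bound_of_continuous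
    (hf1.continuous_fderiv one_ne_zero)
  set g : En n → ℝ := fun x => f x - c with hg_def
  have hg : ContDiff ℝ 1 g := hf1.sub contDiff_const
  have hgM (x) : |g x| ≤ M₀ + |c| := (abs_sub _ _).trans (add_le_add_left (hM₀ x) _)
  have hgf (x) : fderiv ℝ g x = fderiv ℝ f x := fderiv_sub_const c
  have hdinv : Continuous fun x => 1 / d x := continuous_const.div hd fun x => (hd0 x).ne'
  have hε {ε : ℝ} (hε : 0 < ε) : ∫ x, p x / (p x + ε * W x) * g x ^ 2 ∂(boltz V)
      ≤ ∫ x, 1 / d x * ‖gradient f x‖ ^ 2 ∂(boltz V)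
        + β * ∫ x in A, g x ^ 2 ∂(boltz V) := by
    have hW0 (x) : 0 < ε * W x := mul_pos hε (one_pos.trans_le (hW1 x))
    refine (integral_le_of_lyapunov_of_bounded (D := fun x => p x + ε * W x)
      (s := fun x => d x + ε) hV hVint hW hA (hp.add (contDiff_const.mul hW1'))
      (fun x => add_pos (hp0 x) (hW0 x)) (fun x => ?_) (hd.add continuous_const) hε
      (fun x => by linarith [hd0 x]) hp.continuous (fun x => (hp0 x).le)
      (fun x => by linarith [hW0 x]) hL (β := β) (fun x => ?_) hg hgM
      (fun x => by rw [hgf]; exact hM' x)).trans ?_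
    · have := ((hp.differentiable one_ne_zero x).hasFDerivAt).fun_add
        ((hW1'.differentiable one_ne_zero x).hasFDerivAt.const_mul ε)
      rw [this.fderiv, hpd, add_smul]
    · exact (div_le_div_of_nonneg_left hb.le (hp0 x) (by linarith [hW0 x])).trans (hβ x)
    · refine add_le_add_left (integral_mono ?_
        (integrable_mul_norm_gradient_sq hf1 hfc hdinv) fun x => ?_) _
      · have := integrable_mul_norm_gradient_sq (μ := boltz V) hf1 hfc
          (w := fun x => 1 / (d x + ε)) (continuous_const.div (hd.add continuous_const)
          fun x => (add_pos (hd0 x) hε).ne')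
        refine this.congr (.of_forall fun x => ?_)
        simp only [hgf, norm_gradient_eq]
        ring
      · have := hd0 x
        simp only [hgf, norm_gradient_eq]
        rw [div_eq_mul_one_div, mul_comm]
        gcongr
        linarith
  have hlim : Tendsto (fun m : ℕ => ∫ x, p x / (p x + 1 / ((m : ℝ) + 1) * W x) * g x ^ 2
      ∂(boltz V)) atTop (𝓝 (∫ x, g x ^ 2 ∂(boltz V))) := by
    have hW0 (m : ℕ) (x) : 0 < 1 / ((m : ℝ) + 1) * W x :=
      mul_pos (by positivity) (one_pos.trans_le (hW1 x))
    refine tendsto_integral_of_dominated_convergence (fun _ => (M₀ + |c|) ^ 2) (fun m => ?_)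
      (integrable_const _) (fun m => .of_forall fun x => ?_) (.of_forall fun x => ?_)
    · exact ((hp.continuous.div (hp.continuous.add (continuous_const.mul hW.continuous))
        fun x => (add_pos (hp0 x) (hW0 m x)).ne').mul
        (hg.continuous.pow 2)).aestronglyMeasurable
    · have h1 := add_pos (hp0 x) (hW0 m x)
      have h2 := div_nonneg (hp0 x).le h1.le
      rw [Real.norm_of_nonneg (by positivity)]
      refine (mul_le_of_le_one_left (sq_nonneg _)
        ((div_le_one h1).2 (by linarith [hW0 m x]))).trans ?_
      rw [← sq_abs]
      exact pow_le_pow_left₀ (abs_nonneg _) (hgM x) 2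
    · have h := (tendsto_one_div_add_atTop_nhds_zero_nat (𝕜 := ℝ)).mul_const (W x)
      have h' := ((tendsto_const_nhds (x := p x)).div (h.const_add (p x))
        (by simpa using (hp0 x).ne')).mul_const (g x ^ 2)
      simpa [div_self (hp0 x).ne'] using h'
  exact le_of_tendsto' hlim fun m => hε (ε := 1 / ((m : ℝ) + 1)) (by positivity)

/-- a sublinear `φ`-Lyapunov condition plus a local Poincaré inequality implies
the weighted Poincaré inequality
`Var_μ(f) ≤ max(bκ_R/φ(1), 1) ∫ (1 + 1/φ'(W)) |∇f|² dμ`. -/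
theorem stmt6 {n : ℕ} (hn : 0 < n) (V : En n → ℝ) (hV : ContDiff ℝ 2 V)
    (hVint : Integrable (fun x => Real.exp (-V x)))
    (φ : ℝ → ℝ)
    (hφpos : ∀ t ∈ Ici (1 : ℝ), 0 < φ t)
    (hφC1 : ContDiffOn ℝ 1 φ (Ici 1))
    (hφmono : StrictMonoOn φ (Ici 1))
    (hφconc : ConcaveOn ℝ (Ici 1) φ)
    (hφ' : ∀ t ∈ Ici (1 : ℝ), 0 < derivWithin φ (Ici 1) t)
    (W : En n → ℝ) (hW : ContDiff ℝ 2 W) (hW1 : ∀ x, 1 ≤ W x)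
    (b R : ℝ) (hb : 0 < b) (hR : 0 < R)
    (hLyap : ∀ x, Lop V W x ≤ -φ (W x) + (if ‖x‖ ≤ R then b else 0))
    (κ : ℝ)
    (hloc : ∀ f : En n → ℝ, ContDiff ℝ (⊤ : ℕ∞) f → HasCompactSupport f →
      ∫ x in {x : En n | ‖x‖ ≤ R}, (f x) ^ 2 ∂(boltz V)
        ≤ κ * ∫ x, ‖gradient f x‖ ^ 2 ∂(boltz V)
          + ((boltz V) {x : En n | ‖x‖ ≤ R}).toReal⁻¹
              * (∫ x in {x : En n | ‖x‖ ≤ R}, f x ∂(boltz V)) ^ 2)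
    (f : En n → ℝ) (hf : ContDiff ℝ (⊤ : ℕ∞) f) (hfc : HasCompactSupport f) :
    ∫ x, (f x) ^ 2 ∂(boltz V) - (∫ x, f x ∂(boltz V)) ^ 2
      ≤ max (b * κ / φ 1) 1
          * ∫ x, (1 + 1 / derivWithin φ (Ici 1) (W x)) * ‖gradient f x‖ ^ 2 ∂(boltz V) := by
  have hμ := isProbabilityMeasure_boltz hVint
  set A : Set (En n) := {x | ‖x‖ ≤ R}
  have hA : MeasurableSet A := (isClosed_le continuous_norm continuous_const).measurableSet
  have hWmem (x) : W x ∈ Ici (1 : ℝ) := hW1 x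
  have hf1 : ContDiff ℝ 1 f := hf.of_le (by exact_mod_cast le_top)
  have hW1' : ContDiff ℝ 1 W := hW.of_le (by norm_num)
  set p : En n → ℝ := fun x => φ (W x)
  set d : En n → ℝ := fun x => derivWithin φ (Ici 1) (W x)
  have hp : ContDiff ℝ 1 p := hφC1.comp_contDiff hW1' hWmem
  have hp0 (x) : 0 < p x := hφpos _ (hWmem x)
  have hd0 (x) : 0 < d x := hφ' _ (hWmem x)
  have hd : Continuous d := (hφC1.continuousOn_derivWithin (uniqueDiffOn_Ici 1)
    le_rfl).comp_continuous hW.continuous hWmem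
  have hpd (x) : HasFDerivAt p (d x • fderiv ℝ W x) x :=
    ((hφC1.differentiableOn one_ne_zero) _ (hWmem x)).hasDerivWithinAt.comp_hasFDerivAt x
      (hW1'.differentiable one_ne_zero x).hasFDerivAt (.of_forall hWmem)
  have hφ1 : 0 < φ 1 := hφpos 1 self_mem_Ici
  have hφ1p (x) : φ 1 ≤ p x := hφmono.monotoneOn self_mem_Ici (hWmem x) (hW1 x)
  have hL (x) : Lop V W x ≤ -p x + A.indicator (fun _ => b) x := by
    refine (hLyap x).trans_eq ?_
    simp only [indicator, A, mem_ofPred_eq, p]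
  have hfi : Integrable f (boltz V) := hf1.continuous.integrable_of_hasCompactSupport hfc
  have hf2i : Integrable (fun x => f x ^ 2) (boltz V) :=
    integrable_sq_of_hasCompactSupport hf1.continuous hfc
  obtain ⟨c, hc⟩ : ∃ c, c = ((boltz V) A).toReal⁻¹ * ∫ x in A, f x ∂(boltz V) := ⟨_, rfl⟩
  have hgA : ∫ x in A, (f x - c) ^ 2 ∂(boltz V) ≤ κ * ∫ x, ‖gradient f x‖ ^ 2 ∂(boltz V) := by
    have := hloc f hf hfc
    rw [hc, setIntegral_sub_average_sq hfi hf2i A]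
    linarith
  have hmain := integral_sub_const_sq_le_of_lyapunov hV hVint hW hW1 hb hA hp hp0
    (fun x => (hpd x).fderiv) hd hd0 hL
    (fun x => div_le_div_of_nonneg_left hb.le hφ1 (hφ1p x)) hf1 hfc c
  have hvar := integral_sq_sub_sq_integral_le hfi hf2i c
  have hI2 : Integrable (fun x => 1 / d x * ‖gradient f x‖ ^ 2) (boltz V) :=
    integrable_mul_norm_gradient_sq hf1 hfc (continuous_const.div hd fun x => (hd0 x).ne')
  have hI1 : Integrable (fun x => ‖gradient f x‖ ^ 2) (boltz V) := by
    simpa using integrable_mul_norm_gradient_sq (μ := boltz V) hf1 hfc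
      (w := fun _ => 1) continuous_const
  have hsplit : ∫ x, (1 + 1 / d x) * ‖gradient f x‖ ^ 2 ∂(boltz V)
      = ∫ x, ‖gradient f x‖ ^ 2 ∂(boltz V)
        + ∫ x, 1 / d x * ‖gradient f x‖ ^ 2 ∂(boltz V) := by
    rw [← integral_add hI1 hI2]
    congr 1 with x
    ring
  rw [hsplit]
  have hE1 : 0 ≤ ∫ x, ‖gradient f x‖ ^ 2 ∂(boltz V) := integral_nonneg fun x => sq_nonneg _
  have hE2 : 0 ≤ ∫ x, 1 / d x * ‖gradient f x‖ ^ 2 ∂(boltz V) := integral_nonneg fun x => by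
    have := hd0 x
    positivity
  have h1 := mul_le_mul_of_nonneg_right (le_max_left (b * κ / φ 1) 1) hE1
  have h2 := mul_le_mul_of_nonneg_right (le_max_right (b * κ / φ 1) 1) hE2
  have h3 := mul_le_mul_of_nonneg_left hgA (div_pos hb hφ1).le
  have h4 : b / φ 1 * (κ * ∫ x, ‖gradient f x‖ ^ 2 ∂(boltz V))
      = b * κ / φ 1 * ∫ x, ‖gradient f x‖ ^ 2 ∂(boltz V) := by ring
  linarith
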